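/- Let κ ∈ ℝ and β_{ij}(q) = κ Σₖ ε_{ijk} qᵏ/|q|³ on ℝ³∖{0}. For smooth f, g : ℝ³×(ℝ³∖{0}) → ℂ define B₁(f,g) = (i/2)( Σᵢ ∂_{qⁱ}f ∂_{pᵢ}g − ∂_{pᵢ}f ∂_{qⁱ}g + Σ_{i,j} β_{ij} ∂_{pᵢ}f ∂_{pⱼ}g ) and B₂(f,g) = −(1/8)Σ_{i,j}( ∂_{qⁱ}∂_{qʲ}f ∂_{pᵢ}∂_{pⱼ}g − 2 ∂_{qⁱ}∂_{pⱼ}f ∂_{pᵢ}∂_{qʲ}g + ∂_{pᵢ}∂_{pⱼ}f ∂_{qⁱ}∂_{qʲ}g ) − (1/4)Σ_{i,j,k} β_{ij}( ∂_{qᵏ}∂_{pᵢ}f ∂_{pₖ}∂_{pⱼ}g − ∂_{pₖ}∂_{pᵢ}f ∂_{qᵏ}∂_{pⱼ}g ) − (1/8)Σ β_{ij}β_{kl} ∂_{pᵢ}∂_{pₖ}f ∂_{pⱼ}∂_{pₗ}g + (1/12)Σ (∂_{qᵏ}β_{ij})( ∂_{pᵢ}∂_{pₖ}f ∂_{pⱼ}g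 − ∂_{pᵢ}f ∂_{pₖ}∂_{pⱼ}g ). Then for all smooth f, g, h : ℝ³×(ℝ³∖{0}) → ℂ, the second-order associativity condition holds identically: B₂(f,g)·h + B₁(B₁(f,g), h) + B₂(f·g, h) = f·B₂(g,h) + B₁(f, B₁(g,h)) + B₂(f, g·h). -/

import Mathlib

noncomputable section

abbrev R3 : Type := EuclideanSpace ℝ (Fin 3)

/-- The phase space `ℝ³ × ℝ³` with coordinates `(p, q)`;
the physical phase space is the open subset `{z | z.2 ≠ 0}`. -/
abbrev Phase : Type := R3 × R3

/-- Levi-Civita symbol on `Fin 3`. -/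
def eps (i j k : Fin 3) : ℝ :=
  (((j : ℕ) : ℝ) - ((i : ℕ) : ℝ)) * (((k : ℕ) : ℝ) - ((i : ℕ) : ℝ)) *
    (((k : ℕ) : ℝ) - ((j : ℕ) : ℝ)) / 2

/-- Partial derivative `∂_{pᵢ}`. -/
def dp {E : Type} [NormedAddCommGroup E] [NormedSpace ℝ E]
    (i : Fin 3) (f : Phase → E) (z : Phase) : E :=
  fderiv ℝ f z (EuclideanSpace.single i 1, 0)

/-- Partial derivative `∂_{qⁱ}`. -/
def dq {E : Type} [NormedAddCommGroup E] [NormedSpace ℝ E]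
    (i : Fin 3) (f : Phase → E) (z : Phase) : E :=
  fderiv ℝ f z (0, EuclideanSpace.single i 1)

/-- The magnetic matrix `β_{ij}(q) = κ Σₖ ε_{ijk} qᵏ/|q|³`. -/
def beta (κ : ℝ) (i j : Fin 3) (q : R3) : ℝ := κ * ∑ k, eps i j k * q k / ‖q‖^3

/-- `∂_{qᵏ}β_{ij}`. -/
def dbeta (κ : ℝ) (i j k : Fin 3) (q : R3) : ℝ :=
  fderiv ℝ (beta κ i j) q (EuclideanSpace.single k 1)

/-- The first-order term `B₁` of the star product. -/
def B1 (κ : ℝ) (f g : Phase → ℂ) (z : Phase) : ℂ :=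
  (Complex.I / 2) *
    ((∑ i, (dq i f z * dp i g z - dp i f z * dq i g z)) +
      ∑ i, ∑ j, (beta κ i j z.2 : ℂ) * dp i f z * dp j g z)

/-- The second-order term `B₂` of the star product. -/
def B2 (κ : ℝ) (f g : Phase → ℂ) (z : Phase) : ℂ :=
  -(1/8 : ℂ) * ∑ i, ∑ j,
      (dq i (dq j f) z * dp i (dp j g) z - 2 * dq i (dp j f) z * dp i (dq j g) z
        + dp i (dp j f) z * dq i (dq j g) z)
    - (1/4 : ℂ) * ∑ i, ∑ j, ∑ k, (beta κ i j z.2 : ℂ) *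
        (dq k (dp i f) z * dp k (dp j g) z - dp k (dp i f) z * dq k (dp j g) z)
    - (1/8 : ℂ) * ∑ i, ∑ j, ∑ k, ∑ l, (beta κ i j z.2 : ℂ) * (beta κ k l z.2 : ℂ) *
        dp i (dp k f) z * dp j (dp l g) z
    + (1/12 : ℂ) * ∑ i, ∑ j, ∑ k, (dbeta κ i j k z.2 : ℂ) *
        (dp i (dp k f) z * dp j g z - dp i f z * dp k (dp j g) z)

/-- Smoothness at every point of the physical phase space. -/
def SmoothPhase {E : Type} [NormedAddCommGroup E] [NormedSpace ℝ E] (f : Phase → E) : Prop :=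
  ∀ w : Phase, w.2 ≠ 0 → ContDiffAt ℝ (⊤ : ℕ∞) f w

/-- The partial derivative in a fixed direction. -/
def dirD {E : Type} [NormedAddCommGroup E] [NormedSpace ℝ E]
    (v : Phase) (f : Phase → E) (z : Phase) : E := fderiv ℝ f z v

lemma dp_eq_dirD (i : Fin 3) (f : Phase → ℂ) :
    dp i f = dirD (EuclideanSpace.single i 1, 0) f := rfl

lemma dq_eq_dirD (i : Fin 3) (f : Phase → ℂ) :
    dq i f = dirD (0, EuclideanSpace.single i 1) f := rfl

lemma isOpen_physical : IsOpen {z : Phase | z.2 ≠ 0} :=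
  isOpen_ne_fun continuous_snd continuous_const

namespace SmoothPhase

variable {f g : Phase → ℂ}

lemma of_contDiffOn (hf : ContDiffOn ℝ (⊤ : ℕ∞) f {z : Phase | z.2 ≠ 0}) : SmoothPhase f :=
  fun _ hw => hf.contDiffAt (isOpen_physical.mem_nhds hw)

lemma dirD (hf : SmoothPhase f) (v : Phase) : SmoothPhase (dirD v f) := fun w hw =>
  ((hf w hw).fderiv_right (m := (⊤ : ℕ∞)) (by simp)).clm_apply contDiffAt_const

lemma dp (hf : SmoothPhase f) (i : Fin 3) : SmoothPhase (dp i f) := hf.dirD _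

lemma dq (hf : SmoothPhase f) (i : Fin 3) : SmoothPhase (dq i f) := hf.dirD _

lemma mul (hf : SmoothPhase f) (hg : SmoothPhase g) : SmoothPhase (fun w => f w * g w) :=
  fun w hw => (hf w hw).mul (hg w hw)

lemma add (hf : SmoothPhase f) (hg : SmoothPhase g) : SmoothPhase (fun w => f w + g w) :=
  fun w hw => (hf w hw).add (hg w hw)

lemma sub (hf : SmoothPhase f) (hg : SmoothPhase g) : SmoothPhase (fun w => f w - g w) :=
  fun w hw => (hf w hw).sub (hg w hw)

lemma sum {F : Fin 3 → Phase → ℂ} (hF : ∀ i, SmoothPhase (F i)) :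
    SmoothPhase (fun w => ∑ i, F i w) :=
  fun w hw => ContDiffAt.sum fun i _ => hF i w hw

lemma differentiableAt (hf : SmoothPhase f) {w : Phase} (hw : w.2 ≠ 0) :
    DifferentiableAt ℝ f w := (hf w hw).differentiableAt (by simp)

end SmoothPhase

section rules

variable {f g : Phase → ℂ} {z : Phase} (v w : Phase)

lemma dirD_mul (hf : SmoothPhase f) (hg : SmoothPhase g) (hz : z.2 ≠ 0) :
    dirD v (fun x => f x * g x) z = dirD v f z * g z + f z * dirD v g z := by
  simp only [dirD]
  rw [fderiv_fun_mul (hf.differentiableAt hz) (hg.differentiableAt hz)]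
  simp
  ring

lemma dirD_add (hf : SmoothPhase f) (hg : SmoothPhase g) (hz : z.2 ≠ 0) :
    dirD v (fun x => f x + g x) z = dirD v f z + dirD v g z := by
  simp only [dirD]
  rw [fderiv_fun_add (hf.differentiableAt hz) (hg.differentiableAt hz)]
  simp

lemma dirD_sub (hf : SmoothPhase f) (hg : SmoothPhase g) (hz : z.2 ≠ 0) :
    dirD v (fun x => f x - g x) z = dirD v f z - dirD v g z := by
  simp only [dirD]
  rw [fderiv_fun_sub (hf.differentiableAt hz) (hg.differentiableAt hz)]
  simp

lemma dirD_const_mul (c : ℂ) (hf : SmoothPhase f) (hz : z.2 ≠ 0) :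
    dirD v (fun x => c * f x) z = c * dirD v f z := by
  simp only [dirD]
  rw [fderiv_const_mul (hf.differentiableAt hz)]
  simp

lemma dirD_sum {F : Fin 3 → Phase → ℂ} (hF : ∀ i, SmoothPhase (F i)) (hz : z.2 ≠ 0) :
    dirD v (fun x => ∑ i, F i x) z = ∑ i, dirD v (F i) z := by
  simp only [dirD]
  rw [fderiv_fun_sum fun i _ => (hF i).differentiableAt hz]
  simp

lemma dirD_congr (hfg : ∀ x : Phase, x.2 ≠ 0 → f x = g x) (hz : z.2 ≠ 0) :
    dirD v f z = dirD v g z := by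
  simp only [dirD]
  rw [Filter.EventuallyEq.fderiv_eq]
  filter_upwards [isOpen_physical.mem_nhds hz] with x hx using hfg x hx

lemma dirD_comm (hf : SmoothPhase f) (hz : z.2 ≠ 0) :
    dirD v (dirD w f) z = dirD w (dirD v f) z := by
  have hd : DifferentiableAt ℝ (fderiv ℝ f) z :=
    ((hf z hz).fderiv_right (m := (⊤ : ℕ∞)) (by simp)).differentiableAt (by simp)
  have key (a b : Phase) : dirD a (dirD b f) z = fderiv ℝ (fderiv ℝ f) z a b := by
    change fderiv ℝ (fun x => fderiv ℝ f x b) z a = _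
    rw [fderiv_clm_apply hd (differentiableAt_const b)]
    simp
  rw [key, key]
  exact ((hf z hz).isSymmSndFDerivAt (by simp; exact WithTop.coe_le_coe.mpr (le_top : (2 : ℕ∞) ≤ ⊤))) v w

lemma dirD_dirD_mul (hf : SmoothPhase f) (hg : SmoothPhase g) (hz : z.2 ≠ 0) :
    dirD v (dirD w (fun x => f x * g x)) z =
      dirD v (dirD w f) z * g z + dirD w f z * dirD v g z
        + (dirD v f z * dirD w g z + f z * dirD v (dirD w g) z) := by
  rw [dirD_congr v (fun x hx => dirD_mul w hf hg hx) hz,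
    dirD_add v ((hf.dirD w).mul hg) (hf.mul (hg.dirD w)) hz,
    dirD_mul v (hf.dirD w) hg hz, dirD_mul v hf (hg.dirD w) hz]

end rules

lemma contDiffAt_beta (κ : ℝ) (i j : Fin 3) {q : R3} (hq : q ≠ 0) :
    ContDiffAt ℝ (⊤ : ℕ∞) (beta κ i j) q := by
  unfold beta
  refine contDiffAt_const.mul (ContDiffAt.sum fun k _ => ?_)
  refine ContDiffAt.div (contDiffAt_const.mul ?_) ((contDiffAt_norm ℝ hq).pow 3)
    (pow_ne_zero _ (norm_ne_zero_iff.mpr hq))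
  exact (EuclideanSpace.proj (𝕜 := ℝ) k).contDiff.contDiffAt

lemma smoothPhase_beta (κ : ℝ) (i j : Fin 3) :
    SmoothPhase (fun w : Phase => (beta κ i j w.2 : ℂ)) := fun w hw =>
  (Complex.ofRealCLM.contDiff.contDiffAt).comp w
    ((contDiffAt_beta κ i j hw).comp w contDiffAt_snd)

lemma dirD_beta (κ : ℝ) (i j : Fin 3) (v : Phase) {z : Phase} (hz : z.2 ≠ 0) :
    dirD v (fun w : Phase => (beta κ i j w.2 : ℂ)) z
      = (fderiv ℝ (beta κ i j) z.2 v.2 : ℂ) := by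
  have h1 : HasFDerivAt (beta κ i j) (fderiv ℝ (beta κ i j) z.2) z.2 :=
    ((contDiffAt_beta κ i j hz).differentiableAt (by simp)).hasFDerivAt
  have h2 := (Complex.ofRealCLM.hasFDerivAt (x := beta κ i j z.2)).comp z
    (h1.comp z hasFDerivAt_snd)
  have h3 := h2.fderiv
  unfold dirD
  change fderiv ℝ (Complex.ofRealCLM ∘ beta κ i j ∘ Prod.snd) z v = _
  rw [h3]
  simp

/-- The magnetic Poisson bracket, so that `B1 = (i/2) * bracket`. -/
def bracket (κ : ℝ) (f g : Phase → ℂ) (z : Phase) : ℂ :=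
  (∑ i, (dq i f z * dp i g z - dp i f z * dq i g z)) +
    ∑ i, ∑ j, (beta κ i j z.2 : ℂ) * dp i f z * dp j g z

lemma bracket_def (κ : ℝ) (f g : Phase → ℂ) (z : Phase) :
    bracket κ f g z = (∑ i, (dq i f z * dp i g z - dp i f z * dq i g z)) +
      ∑ i, ∑ j, (beta κ i j z.2 : ℂ) * dp i f z * dp j g z := rfl

section bracket

variable (κ : ℝ) {f g h : Phase → ℂ} {z : Phase}

lemma smoothPhase_bracket (hf : SmoothPhase f) (hg : SmoothPhase g) :
    SmoothPhase (bracket κ f g) :=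
  (SmoothPhase.sum fun i => ((hf.dq i).mul (hg.dp i)).sub ((hf.dp i).mul (hg.dq i))).add
    (SmoothPhase.sum fun i => SmoothPhase.sum fun j =>
      ((smoothPhase_beta κ i j).mul (hf.dp i)).mul (hg.dp j))

lemma bracket_const_mul_left (c : ℂ) (hf : SmoothPhase f) (hz : z.2 ≠ 0) :
    bracket κ (fun w => c * f w) g z = c * bracket κ f g z := by
  simp only [bracket, dp_eq_dirD, dq_eq_dirD, dirD_const_mul _ c hf hz, Fin.sum_univ_three]
  ring

lemma bracket_const_mul_right (c : ℂ) (hg : SmoothPhase g) (hz : z.2 ≠ 0) :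
    bracket κ f (fun w => c * g w) z = c * bracket κ f g z := by
  simp only [bracket, dp_eq_dirD, dq_eq_dirD, dirD_const_mul _ c hg hz, Fin.sum_univ_three]
  ring

lemma B1_B1_left (hf : SmoothPhase f) (hg : SmoothPhase g) (hz : z.2 ≠ 0) :
    B1 κ (fun w => B1 κ f g w) h z = -(1 / 4) * bracket κ (bracket κ f g) h z := by
  change Complex.I / 2 * bracket κ (fun w => Complex.I / 2 * bracket κ f g w) h z = _
  rw [bracket_const_mul_left κ _ (smoothPhase_bracket κ hf hg) hz]
  linear_combination bracket κ (bracket κ f g) h z / 4 * Complex.I_sq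

lemma B1_B1_right (hg : SmoothPhase g) (hh : SmoothPhase h) (hz : z.2 ≠ 0) :
    B1 κ f (fun w => B1 κ g h w) z = -(1 / 4) * bracket κ f (bracket κ g h) z := by
  change Complex.I / 2 * bracket κ f (fun w => Complex.I / 2 * bracket κ g h w) z = _
  rw [bracket_const_mul_right κ _ (smoothPhase_bracket κ hg hh) hz]
  linear_combination bracket κ f (bracket κ g h) z / 4 * Complex.I_sq

lemma dirD_bracket (hf : SmoothPhase f) (hg : SmoothPhase g) (hz : z.2 ≠ 0) (v : Phase) :
    dirD v (bracket κ f g) z = bracket κ (dirD v f) g z + bracket κ f (dirD v g) z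
      + ∑ i, ∑ j, (fderiv ℝ (beta κ i j) z.2 v.2 : ℂ) * dp i f z * dp j g z := by
  have hb := smoothPhase_beta κ
  have h1 (i : Fin 3) : SmoothPhase fun w => dq i f w * dp i g w - dp i f w * dq i g w :=
    ((hf.dq i).mul (hg.dp i)).sub ((hf.dp i).mul (hg.dq i))
  have h2 (i j : Fin 3) : SmoothPhase fun w => (beta κ i j w.2 : ℂ) * dp i f w * dp j g w :=
    ((hb i j).mul (hf.dp i)).mul (hg.dp j)
  have h3 (i : Fin 3) := SmoothPhase.sum (h2 i)
  unfold bracket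
  rw [dirD_add v (SmoothPhase.sum h1) (SmoothPhase.sum h3) hz, dirD_sum v h1 hz, dirD_sum v h3 hz]
  simp only [dirD_sum v (h2 _) hz]
  have e1 (i : Fin 3) := dirD_sub v ((hf.dq i).mul (hg.dp i)) ((hf.dp i).mul (hg.dq i)) hz
  have e2 (i j : Fin 3) := dirD_mul v ((hb i j).mul (hf.dp i)) (hg.dp j) hz
  have e3 (i j : Fin 3) := dirD_mul v (hb i j) (hf.dp i) hz
  have e4 (i : Fin 3) := dirD_mul v (hf.dq i) (hg.dp i) hz
  have e5 (i : Fin 3) := dirD_mul v (hf.dp i) (hg.dq i) hz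
  simp only [e1, e2, e3, e4, e5, dirD_beta κ _ _ v hz]
  simp only [dp_eq_dirD, dq_eq_dirD]
  simp only [dirD_comm v _ hf hz, dirD_comm v _ hg hz]
  simp only [Fin.sum_univ_three]
  ring

end bracket

lemma beta_antisymm (κ : ℝ) (i j : Fin 3) (q : R3) : beta κ j i q = -beta κ i j q := by
  simp only [beta, eps, ← mul_neg, ← Finset.sum_neg_distrib]
  congr 1
  refine Finset.sum_congr rfl fun k _ => ?_
  ring

lemma dbeta_antisymm (κ : ℝ) (i j k : Fin 3) (q : R3) :
    dbeta κ j i k q = -dbeta κ i j k q := by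
  have h : beta κ j i = fun x => -beta κ i j x := funext (beta_antisymm κ i j)
  simp only [dbeta, h, fderiv_fun_neg, neg_apply]

lemma fderiv_norm_mul_norm {q : R3} (hq : q ≠ 0) (k : Fin 3) :
    ‖q‖ * fderiv ℝ (fun x : R3 => ‖x‖) q (EuclideanSpace.single k 1) = q k := by
  have hd : DifferentiableAt ℝ (fun x : R3 => ‖x‖) q :=
    (contDiffAt_norm ℝ (n := 1) hq).differentiableAt (by simp)
  have h1 := (hd.hasFDerivAt.pow 2).unique (hasStrictFDerivAt_norm_sq q).hasFDerivAt
  have h2 := congrArg (fun L => L (EuclideanSpace.single k (1 : ℝ))) h1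
  simp [EuclideanSpace.inner_single_right] at h2
  linarith

lemma fderiv_coord_div (κ : ℝ) (k l : Fin 3) {q : R3} (hq : q ≠ 0) :
    fderiv ℝ (fun x : R3 => κ * (x k / ‖x‖ ^ 3)) q (EuclideanSpace.single l 1)
      = κ * ((if k = l then 1 else 0) / ‖q‖ ^ 3 - 3 * q k * q l / ‖q‖ ^ 5) := by
  have hn : ‖q‖ ≠ 0 := norm_ne_zero_iff.mpr hq
  have hd : DifferentiableAt ℝ (fun x : R3 => ‖x‖) q :=
    (contDiffAt_norm ℝ (n := 1) hq).differentiableAt (by simp)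
  have hk : HasFDerivAt (fun x : R3 => x k) (EuclideanSpace.proj (𝕜 := ℝ) k) q :=
    (EuclideanSpace.proj (𝕜 := ℝ) k).hasFDerivAt
  have h3 : HasFDerivAt (fun x : R3 => ‖x‖ ^ 3)
      ((3 * ‖q‖ ^ 2) • fderiv ℝ (fun x : R3 => ‖x‖) q) q := by
    simpa using hd.hasFDerivAt.pow 3
  have hi : HasFDerivAt (fun x : R3 => (‖x‖ ^ 3)⁻¹)
      ((-((‖q‖ ^ 3) ^ 2)⁻¹) • (3 * ‖q‖ ^ 2) • fderiv ℝ (fun x : R3 => ‖x‖) q) q :=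
    HasDerivAt.comp_hasFDerivAt (h₂ := fun y : ℝ => y⁻¹) q (hasDerivAt_inv (pow_ne_zero 3 hn)) h3
  have h : HasFDerivAt (fun x : R3 => κ * (x k / ‖x‖ ^ 3)) _ q := (hk.mul hi).const_mul κ
  rw [h.fderiv, ← fderiv_norm_mul_norm hq l]
  by_cases hkl : k = l
  · simp [hkl]
    field_simp
    ring
  · simp [hkl]
    field_simp
    simp

lemma dbeta_cyclic (κ : ℝ) {q : R3} (hq : q ≠ 0) :
    dbeta κ 0 1 2 q + dbeta κ 1 2 0 q + dbeta κ 2 0 1 q = 0 := by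
  have hn : ‖q‖ ≠ 0 := norm_ne_zero_iff.mpr hq
  have hs : ‖q‖ ^ 2 = q 0 ^ 2 + q 1 ^ 2 + q 2 ^ 2 := by
    rw [EuclideanSpace.norm_sq_eq]
    simp [Fin.sum_univ_three]
  have h01 : beta κ 0 1 = fun x : R3 => κ * (x 2 / ‖x‖ ^ 3) := by
    funext x; norm_num [beta, eps, Fin.sum_univ_three]
  have h12 : beta κ 1 2 = fun x : R3 => κ * (x 0 / ‖x‖ ^ 3) := by
    funext x; norm_num [beta, eps, Fin.sum_univ_three]
  have h20 : beta κ 2 0 = fun x : R3 => κ * (x 1 / ‖x‖ ^ 3) := by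
    funext x; norm_num [beta, eps, Fin.sum_univ_three]
  simp only [dbeta, h01, h12, h20, fderiv_coord_div κ _ _ hq]
  simp only [if_true]
  field_simp
  linear_combination 3 * κ * hs

set_option maxHeartbeats 4000000 in
/-- the second-order associativity condition
`B₂(f,g)h + B₁(B₁(f,g),h) + B₂(fg,h) = fB₂(g,h) + B₁(f,B₁(g,h)) + B₂(f,gh)`. -/
theorem stmt16 (κ : ℝ) (f g h : Phase → ℂ)
    (hf : ContDiffOn ℝ (⊤ : ℕ∞) f {z : Phase | z.2 ≠ 0})
    (hg : ContDiffOn ℝ (⊤ : ℕ∞) g {z : Phase | z.2 ≠ 0})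
    (hh : ContDiffOn ℝ (⊤ : ℕ∞) h {z : Phase | z.2 ≠ 0})
    (z : Phase) (hz : z.2 ≠ 0) :
    B2 κ f g z * h z + B1 κ (fun w => B1 κ f g w) h z + B2 κ (fun w => f w * g w) h z
      = f z * B2 κ g h z + B1 κ f (fun w => B1 κ g h w) z
        + B2 κ f (fun w => g w * h w) z := by
  have hf := SmoothPhase.of_contDiffOn hf
  have hg := SmoothPhase.of_contDiffOn hg
  have hh := SmoothPhase.of_contDiffOn hh
  have b00 (i : Fin 3) : (beta κ i i z.2 : ℂ) = 0 := by
    exact_mod_cast self_eq_neg.mp (beta_antisymm κ i i z.2)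
  have b10 : (beta κ 1 0 z.2 : ℂ) = -(beta κ 0 1 z.2 : ℂ) := by
    exact_mod_cast beta_antisymm κ 0 1 z.2
  have b21 : (beta κ 2 1 z.2 : ℂ) = -(beta κ 1 2 z.2 : ℂ) := by
    exact_mod_cast beta_antisymm κ 1 2 z.2
  have b02 : (beta κ 0 2 z.2 : ℂ) = -(beta κ 2 0 z.2 : ℂ) := by
    exact_mod_cast beta_antisymm κ 2 0 z.2
  have c00 (i k : Fin 3) : (dbeta κ i i k z.2 : ℂ) = 0 := by
    exact_mod_cast self_eq_neg.mp (dbeta_antisymm κ i i k z.2)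
  have c10 (k : Fin 3) : (dbeta κ 1 0 k z.2 : ℂ) = -(dbeta κ 0 1 k z.2 : ℂ) := by
    exact_mod_cast dbeta_antisymm κ 0 1 k z.2
  have c21 (k : Fin 3) : (dbeta κ 2 1 k z.2 : ℂ) = -(dbeta κ 1 2 k z.2 : ℂ) := by
    exact_mod_cast dbeta_antisymm κ 1 2 k z.2
  have c02 (k : Fin 3) : (dbeta κ 0 2 k z.2 : ℂ) = -(dbeta κ 2 0 k z.2 : ℂ) := by
    exact_mod_cast dbeta_antisymm κ 2 0 k z.2
  have hcyc : (dbeta κ 2 0 1 z.2 : ℂ) = -dbeta κ 0 1 2 z.2 - dbeta κ 1 2 0 z.2 := by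
    exact_mod_cast (by linear_combination dbeta_cyclic κ hz :
      dbeta κ 2 0 1 z.2 = -dbeta κ 0 1 2 z.2 - dbeta κ 1 2 0 z.2)
  have Bq {a b : Phase → ℂ} (ha : SmoothPhase a) (hb : SmoothPhase b) (k : Fin 3) :
      dq k (bracket κ a b) z = bracket κ (dq k a) b z + bracket κ a (dq k b) z
        + ∑ i, ∑ j, (dbeta κ i j k z.2 : ℂ) * dp i a z * dp j b z :=
    dirD_bracket κ ha hb hz _
  have Bp {a b : Phase → ℂ} (ha : SmoothPhase a) (hb : SmoothPhase b) (k : Fin 3) :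
      dp k (bracket κ a b) z = bracket κ (dp k a) b z + bracket κ a (dp k b) z := by
    have e := dirD_bracket κ ha hb hz (EuclideanSpace.single k 1, 0)
    simp only [map_zero, Complex.ofReal_zero, zero_mul, Finset.sum_const_zero, add_zero] at e
    exact e
  have Mp {a b : Phase → ℂ} (ha : SmoothPhase a) (hb : SmoothPhase b) (i : Fin 3) :
      dp i (fun w => a w * b w) z = dp i a z * b z + a z * dp i b z := dirD_mul _ ha hb hz
  have Mpp {a b : Phase → ℂ} (ha : SmoothPhase a) (hb : SmoothPhase b) (i j : Fin 3) :
      dp i (dp j (fun w => a w * b w)) z = dp i (dp j a) z * b z + dp j a z * dp i b z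
        + (dp i a z * dp j b z + a z * dp i (dp j b) z) := dirD_dirD_mul _ _ ha hb hz
  have Mqp {a b : Phase → ℂ} (ha : SmoothPhase a) (hb : SmoothPhase b) (i j : Fin 3) :
      dq i (dp j (fun w => a w * b w)) z = dq i (dp j a) z * b z + dp j a z * dq i b z
        + (dq i a z * dp j b z + a z * dq i (dp j b) z) := dirD_dirD_mul _ _ ha hb hz
  have Mpq {a b : Phase → ℂ} (ha : SmoothPhase a) (hb : SmoothPhase b) (i j : Fin 3) :
      dp i (dq j (fun w => a w * b w)) z = dp i (dq j a) z * b z + dq j a z * dp i b z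
        + (dp i a z * dq j b z + a z * dp i (dq j b) z) := dirD_dirD_mul _ _ ha hb hz
  have Mqq {a b : Phase → ℂ} (ha : SmoothPhase a) (hb : SmoothPhase b) (i j : Fin 3) :
      dq i (dq j (fun w => a w * b w)) z = dq i (dq j a) z * b z + dq j a z * dq i b z
        + (dq i a z * dq j b z + a z * dq i (dq j b) z) := dirD_dirD_mul _ _ ha hb hz
  have Cpq {a : Phase → ℂ} (ha : SmoothPhase a) (i j : Fin 3) :
      dp i (dq j a) z = dq j (dp i a) z := dirD_comm _ _ ha hz
  have Cpp {a : Phase → ℂ} (ha : SmoothPhase a) (i j : Fin 3) :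
      dp i (dp j a) z = dp j (dp i a) z := dirD_comm _ _ ha hz
  have Cqq {a : Phase → ℂ} (ha : SmoothPhase a) (i j : Fin 3) :
      dq i (dq j a) z = dq j (dq i a) z := dirD_comm _ _ ha hz
  rw [B1_B1_left κ hf hg hz, B1_B1_right κ hg hh hz,
    bracket_def κ (bracket κ f g), bracket_def κ f (bracket κ g h)]
  simp only [B2, Bq hf hg, Bq hg hh, Bp hf hg, Bp hg hh, Mp hf hg, Mp hg hh,
    Mpp hf hg, Mpp hg hh, Mpq hg hh, Mqp hf hg, Mqp hg hh, Mqq hf hg, Mqq hg hh]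
  simp only [bracket]
  simp only [Cpq hf, Cpq hg, Cpq hh, Fin.sum_univ_three, b00, b10, b21, b02,
    c00, c10, c21, c02, hcyc]
  simp only [Cpp hf 1 0, Cpp hf 2 0, Cpp hf 2 1, Cpp hg 1 0, Cpp hg 2 0, Cpp hg 2 1,
    Cpp hh 1 0, Cpp hh 2 0, Cpp hh 2 1, Cqq hf 1 0, Cqq hf 2 0, Cqq hf 2 1,
    Cqq hg 1 0, Cqq hg 2 0, Cqq hg 2 1, Cqq hh 1 0, Cqq hh 2 0, Cqq hh 2 1,
    zero_mul, mul_zero, add_zero, zero_add, neg_mul]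
  ring
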